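/- Let Φ be a finite reduced crystallographic root system with base S in a finite-dimensional real inner product space V, and let s be a folding of S. For each orbit o of s on S define the orbit sum γ_o∨ := Σ_{α∈o} α∨ ∈ V, where α∨ = 2α/(α,α). Then the set {γ_o∨ : o an orbit of s on S} is linearly independent and is the base of a finite reduced crystallographic root system in its span (with respect to the inner product on V); in particular, for distinct orbits o ≠ o′ the number 2(γ_o∨, γ_{o′}∨)/(γ_{o′}∨, γ_{o′}∨) is a nonpositive integer. -/

import Mathlib

open RealInnerProductSpace

variable {V : Type*} [NormedAddCommGroup V] [InnerProductSpace ℝ V]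

/-- The pairing `⟨x | v∨⟩ = 2(x,v)/(v,v)` of a vector against the "coroot" of `v`. -/
noncomputable def pairR (x v : V) : ℝ := 2 * ⟪x, v⟫ / ⟪v, v⟫

/-- The reflection `s_v(x) = x - ⟨x|v∨⟩ v` in the nonzero vector `v`. -/
noncomputable def reflV (v x : V) : V := x - pairR x v • v

/-- A finite reduced crystallographic root system in a real inner product space:
a finite set of nonzero vectors, closed under all of its reflections, with integral
Cartan numbers, such that the only multiples of a root `α` that are roots are `±α`. -/
def IsRootSystem (Φ : Set V) : Prop :=
  Φ.Finite ∧
  (0 : V) ∉ Φ ∧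
  (∀ α ∈ Φ, ∀ β ∈ Φ, reflV α β ∈ Φ) ∧
  (∀ α ∈ Φ, ∀ β ∈ Φ, ∃ n : ℤ, pairR β α = (n : ℝ)) ∧
  (∀ α ∈ Φ, ∀ c : ℝ, c • α ∈ Φ → c • α = α ∨ c • α = -α)

/-- `S` is a base of `Φ`: a linearly independent subset spanning the span of `Φ`
such that every element of `Φ` is an integral linear combination of `S` with
coefficients all of the same sign. -/
def IsBase (Φ S : Set V) : Prop :=
  S ⊆ Φ ∧
  LinearIndependent ℝ ((↑) : S → V) ∧
  Submodule.span ℝ S = Submodule.span ℝ Φ ∧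
  ∀ α ∈ Φ, ∃ c : V →₀ ℤ,
    (↑c.support : Set V) ⊆ S ∧
    α = c.sum (fun v n => (n : ℝ) • v) ∧
    ((∀ v, 0 ≤ c v) ∨ (∀ v, c v ≤ 0))

/-- The positive elements with respect to a base `S`: nonnegative integral
combinations of `S`. -/
def IsPositive (S : Set V) (α : V) : Prop :=
  ∃ c : V →₀ ℤ,
    (↑c.support : Set V) ⊆ S ∧
    α = c.sum (fun v n => (n : ℝ) • v) ∧
    (∀ v, 0 ≤ c v)

/-- `Ψ` is a root subsystem of `Φ`: a nonempty subset stable under its own reflections. -/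
def IsRootSubsystem (Φ Ψ : Set V) : Prop :=
  Ψ ⊆ Φ ∧ Ψ.Nonempty ∧ ∀ ψ ∈ Ψ, ∀ x ∈ Ψ, reflV ψ x ∈ Ψ

/-- `Ψ` is additively closed in `Φ` : `Ψ = Φ ∩ ℤΨ`. -/
def IsAddClosedIn (Φ Ψ : Set V) : Prop :=
  Ψ = Φ ∩ (Submodule.span ℤ Ψ : Set V)

/-- The coroot `v∨ = 2v/(v,v)` of a nonzero vector `v`. -/
noncomputable def corootV (v : V) : V := (2 / ⟪v, v⟫) • v

/-- `s` is a folding of the base `S`: an involution of `S` such that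
`⟨α|sα∨⟩ = 0` whenever `sα ≠ α`, and `⟨α - sα | β∨ + sβ∨⟩ = 0` for all `α, β ∈ S`. -/
def IsFolding (S : Set V) (s : V → V) : Prop :=
  (∀ α ∈ S, s α ∈ S) ∧ (∀ α ∈ S, s (s α) = α) ∧
  (∀ α ∈ S, s α ≠ α → pairR α (s α) = 0) ∧
  (∀ α ∈ S, ∀ β ∈ S, pairR (α - s α) β + pairR (α - s α) (s β) = 0)

open scoped Classical in
/-- The set of orbit sums of coroots `γ_o∨ = Σ_{α ∈ o} α∨`, one for each orbit `o` of
the folding `s` on `S`. -/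
noncomputable def orbitSums (s : V → V) (S : Set V) : Set V :=
  (fun α => if s α = α then corootV α else corootV α + corootV (s α)) '' S

section ReflectionBasics

theorem pairR_add_left (x y v : V) : pairR (x + y) v = pairR x v + pairR y v := by
  simp only [pairR, inner_add_left]; ring

theorem pairR_sub_left (x y v : V) : pairR (x - y) v = pairR x v - pairR y v := by
  simp only [pairR, inner_sub_left]; ring

theorem pairR_smul_left (a : ℝ) (x v : V) : pairR (a • x) v = a * pairR x v := by
  simp only [pairR, real_inner_smul_left]; ring

theorem pairR_self {v : V} (hv : v ≠ 0) : pairR v v = 2 := by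
  have : (⟪v, v⟫ : ℝ) ≠ 0 := inner_self_ne_zero.mpr hv
  simp only [pairR]; field_simp

theorem pairR_mul_inner_self {v : V} (hv : v ≠ 0) (x : V) : pairR x v * ⟪v, v⟫ = 2 * ⟪x, v⟫ := by
  have : (⟪v, v⟫ : ℝ) ≠ 0 := inner_self_ne_zero.mpr hv
  simp only [pairR]; field_simp

theorem inner_reflV_reflV {v : V} (hv : v ≠ 0) (x y : V) :
    (⟪reflV v x, reflV v y⟫ : ℝ) = ⟪x, y⟫ := by
  have h : (⟪v, v⟫ : ℝ) ≠ 0 := inner_self_ne_zero.mpr hv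
  simp only [reflV, pairR, inner_sub_left, inner_sub_right, real_inner_smul_left,
    real_inner_smul_right, real_inner_comm v y]
  field_simp
  ring

theorem reflV_reflV {v : V} (hv : v ≠ 0) (x : V) : reflV v (reflV v x) = x := by
  have h : pairR (reflV v x) v = -pairR x v := by
    rw [reflV, pairR_sub_left, pairR_smul_left, pairR_self hv]; ring
  rw [reflV, h, reflV]; module

theorem pairR_reflV_right {v : V} (hv : v ≠ 0) (x y : V) :
    pairR x (reflV v y) = pairR (reflV v x) y := by
  have h : (⟪x, reflV v y⟫ : ℝ) = ⟪reflV v x, y⟫ := by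
    rw [← inner_reflV_reflV hv x, reflV_reflV hv]
  rw [pairR, pairR, h, inner_reflV_reflV hv]

theorem reflV_self {v : V} (hv : v ≠ 0) : reflV v v = -v := by
  rw [reflV, pairR_self hv]; module

theorem reflV_ne_zero {v x : V} (hv : v ≠ 0) (hx : x ≠ 0) : reflV v x ≠ 0 := by
  rw [← inner_self_ne_zero (𝕜 := ℝ), inner_reflV_reflV hv]
  exact inner_self_ne_zero.mpr hx

/-- The reflection in `v` as a linear map. -/
noncomputable def reflVLinear (v : V) : V →ₗ[ℝ] V where
  toFun := reflV v
  map_add' x y := by simp only [reflV, pairR_add_left]; module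
  map_smul' a x := by simp only [reflV, pairR_smul_left, RingHom.id_apply]; module

theorem IsRootSystem.ne_zero {Φ : Set V} (h : IsRootSystem Φ) {α : V} (hα : α ∈ Φ) : α ≠ 0 :=
  fun h0 => h.2.1 (h0 ▸ hα)

theorem IsRootSystem.neg_mem {Φ : Set V} (h : IsRootSystem Φ) {α : V} (hα : α ∈ Φ) : -α ∈ Φ :=
  reflV_self (h.ne_zero hα) ▸ h.2.2.1 α hα α hα

theorem IsRootSystem.sub_mem {Φ : Set V} (h : IsRootSystem Φ) {α β : V} (hα : α ∈ Φ) (hβ : β ∈ Φ)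
    (hpos : (0 : ℝ) < ⟪α, β⟫) (hne : α ≠ β) : α - β ∈ Φ := by
  obtain ⟨m, hm⟩ := h.2.2.2.1 β hβ α hα
  obtain ⟨n, hn⟩ := h.2.2.2.1 α hα β hβ
  have ha : (0 : ℝ) < ⟪α, α⟫ := real_inner_self_pos.mpr (h.ne_zero hα)
  have hb : (0 : ℝ) < ⟪β, β⟫ := real_inner_self_pos.mpr (h.ne_zero hβ)
  have em := pairR_mul_inner_self (h.ne_zero hβ) α
  have en := pairR_mul_inner_self (h.ne_zero hα) β
  rw [hm] at em
  rw [hn, real_inner_comm α β] at en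
  have hm0 : 0 < m := by
    have : (0 : ℝ) < m := by
      by_contra! hc
      nlinarith
    exact_mod_cast this
  have hn0 : 0 < n := by
    have : (0 : ℝ) < n := by
      by_contra! hc
      nlinarith
    exact_mod_cast this
  have hmn : m * n ≤ 4 := by
    have hcs := real_inner_mul_inner_self_le α β
    have e : (m * n : ℝ) * (⟪α, α⟫ * ⟪β, β⟫) = 4 * (⟪α, β⟫ * ⟪α, β⟫) := by
      linear_combination (n * ⟪α, α⟫ : ℝ) * em + 2 * ⟪α, β⟫ * en
    have : (m * n : ℝ) ≤ 4 := by
      by_contra! hc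
      nlinarith [mul_pos ha hb]
    exact_mod_cast this
  by_cases hm1 : m = 1
  · have := h.2.2.1 β hβ α hα
    rwa [reflV, hm, hm1, Int.cast_one, one_smul] at this
  by_cases hn1 : n = 1
  · have := h.neg_mem (h.2.2.1 α hα β hβ)
    rwa [reflV, hn, hn1, Int.cast_one, one_smul, neg_sub] at this
  have hm2 : m = 2 := by nlinarith [show 2 ≤ m by omega, show 2 ≤ n by omega]
  have hn2 : n = 2 := by subst hm2; omega
  rw [hm2] at em
  rw [hn2] at en
  push_cast at em en
  refine absurd (sub_eq_zero.mp (inner_self_eq_zero (𝕜 := ℝ).mp ?_)) hne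
  rw [real_inner_sub_sub_self]
  linarith

end ReflectionBasics

theorem LinearIndependent.exists_dual_family {ι : Type*} {b : ι → V} (hb : LinearIndependent ℝ b) :
    ∃ φ : ι → V →ₗ[ℝ] ℝ, ∀ i, φ i (b i) = 1 ∧ ∀ j, j ≠ i → φ i (b j) = 0 := by
  have h : ∀ i, ∃ f : V →ₗ[ℝ] ℝ, f (b i) = 1 ∧ ∀ j, j ≠ i → f (b j) = 0 := by
    intro i
    obtain ⟨f, hf⟩ := LinearMap.exists_extend ((Module.Basis.span hb).coord i)
    have key : ∀ j, f (b j) = (Module.Basis.span hb).coord i (Module.Basis.span hb j) := by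
      intro j
      rw [← hf, LinearMap.comp_apply, Submodule.subtype_apply, Module.Basis.span_apply]
    refine ⟨f, ?_, fun j hj => ?_⟩
    · simp [key]
    · simp [key, hj]
  choose φ hφ using h
  exact ⟨φ, hφ⟩

/-- The smallest set containing `T` and stable under the reflections in its own elements. -/
inductive ReflClosure (T : Set V) : V → Prop
  | basic (v : V) : v ∈ T → ReflClosure T v
  | refl (u v : V) : ReflClosure T u → ReflClosure T v → ReflClosure T (reflV u v)

section ObtuseBasis

variable {ι : Type*} {b : ι → V} {φ : ι → V →ₗ[ℝ] ℝ}

/-- The properties of the family `b` that persist for the vectors obtained from it by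
successive reflections; `φ` is a dual family. -/
structure IsRealRoot (b : ι → V) (φ : ι → V →ₗ[ℝ] ℝ) (α : V) : Prop where
  mem : α ∈ Submodule.span ℤ (Set.range b)
  ne_zero : α ≠ 0
  integral : ∀ x ∈ Submodule.span ℤ (Set.range b), ∃ n : ℤ, pairR x α = n
  inner_self : ∃ k, (⟪α, α⟫ : ℝ) = ⟪b k, b k⟫
  primitive : ∃ f : V →ₗ[ℝ] ℝ,
    (∀ x ∈ Submodule.span ℤ (Set.range b), ∃ n : ℤ, f x = n) ∧ f α = 1
  coroot_integral : ∀ i, ∃ d : ℤ, φ i α * ⟪b i, b i⟫ = d * ⟪α, α⟫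

theorem exists_int_eq_of_mem_span {f : V →ₗ[ℝ] ℝ} (h : ∀ i, ∃ n : ℤ, f (b i) = n) {x : V}
    (hx : x ∈ Submodule.span ℤ (Set.range b)) : ∃ n : ℤ, f x = n := by
  induction hx using Submodule.span_induction with
  | mem x hx => obtain ⟨i, rfl⟩ := hx; exact h i
  | zero => exact ⟨0, by simp⟩
  | add x y _ _ hx hy =>
    obtain ⟨m, hm⟩ := hx
    obtain ⟨n, hn⟩ := hy
    exact ⟨m + n, by simp [hm, hn]⟩
  | smul a x _ hx =>
    obtain ⟨m, hm⟩ := hx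
    exact ⟨a * m, by rw [map_zsmul, hm]; simp⟩

theorem IsRealRoot.reflV_mem {α x : V} (hα : IsRealRoot b φ α)
    (hx : x ∈ Submodule.span ℤ (Set.range b)) : reflV α x ∈ Submodule.span ℤ (Set.range b) := by
  obtain ⟨n, hn⟩ := hα.integral x hx
  rw [reflV, hn, Int.cast_smul_eq_zsmul]
  exact sub_mem hx (Submodule.smul_mem _ n hα.mem)

theorem IsRealRoot.reflV {α β : V} (hα : IsRealRoot b φ α) (hβ : IsRealRoot b φ β) :
    IsRealRoot b φ (reflV α β) where
  mem := hα.reflV_mem hβ.mem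
  ne_zero := reflV_ne_zero hα.ne_zero hβ.ne_zero
  integral x hx := by
    rw [pairR_reflV_right hα.ne_zero]
    exact hβ.integral _ (hα.reflV_mem hx)
  inner_self := by
    rw [inner_reflV_reflV hα.ne_zero]
    exact hβ.inner_self
  primitive := by
    obtain ⟨f, hf, hf1⟩ := hβ.primitive
    refine ⟨f ∘ₗ reflVLinear α, fun x hx => hf _ (hα.reflV_mem hx), ?_⟩
    change f (_root_.reflV α (_root_.reflV α β)) = 1
    rw [reflV_reflV hα.ne_zero, hf1]
  coroot_integral i := by
    obtain ⟨d, hd⟩ := hα.coroot_integral i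
    obtain ⟨e, he⟩ := hβ.coroot_integral i
    obtain ⟨n, hn⟩ := hβ.integral α hα.mem
    refine ⟨e - n * d, ?_⟩
    rw [inner_reflV_reflV hα.ne_zero, _root_.reflV, map_sub, map_smul, smul_eq_mul]
    have h1 := pairR_mul_inner_self hα.ne_zero β
    have h2 := pairR_mul_inner_self hβ.ne_zero α
    rw [hn, real_inner_comm β α] at h2
    push_cast
    linear_combination he - pairR β α * hd - d * h1 + d * h2

theorem isRealRoot_basis (hφ : ∀ i, φ i (b i) = 1 ∧ ∀ j, j ≠ i → φ i (b j) = 0)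
    (hb0 : ∀ i, b i ≠ 0) (hpair : ∀ i j, i ≠ j → ∃ n : ℤ, n ≤ 0 ∧ pairR (b i) (b j) = n) (k : ι) :
    IsRealRoot b φ (b k) where
  mem := Submodule.subset_span ⟨k, rfl⟩
  ne_zero := hb0 k
  integral x hx := by
    let f : V →ₗ[ℝ] ℝ :=
      { toFun := fun x => pairR x (b k)
        map_add' := fun x y => pairR_add_left x y _
        map_smul' := fun a x => pairR_smul_left a x _ }
    refine exists_int_eq_of_mem_span (f := f) (fun i => ?_) hx
    by_cases h : i = k
    · subst h
      exact ⟨2, (pairR_self (hb0 i)).trans (by norm_num)⟩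
    · obtain ⟨n, -, hn⟩ := hpair i k h
      exact ⟨n, hn⟩
  inner_self := ⟨k, rfl⟩
  primitive := by
    refine ⟨φ k, fun x hx => exists_int_eq_of_mem_span (fun i => ?_) hx, (hφ k).1⟩
    by_cases h : i = k
    · subst h
      exact ⟨1, by simpa using (hφ i).1⟩
    · exact ⟨0, by simpa using (hφ k).2 i h⟩
  coroot_integral i := by
    by_cases h : k = i
    · subst h
      exact ⟨1, by simp [(hφ k).1]⟩
    · exact ⟨0, by simp [(hφ i).2 k h]⟩

theorem dual_apply_sum [Fintype ι] (hφ : ∀ i, φ i (b i) = 1 ∧ ∀ j, j ≠ i → φ i (b j) = 0) (c : ι → ℝ) (i : ι) :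
    φ i (∑ j, c j • b j) = c i := by
  rw [map_sum, Finset.sum_eq_single i]
  · simp [(hφ i).1]
  · intro j _ hj
    simp [(hφ i).2 j hj]
  · simp

theorem eq_sum_dual_smul [Fintype ι] (hφ : ∀ i, φ i (b i) = 1 ∧ ∀ j, j ≠ i → φ i (b j) = 0) {x : V}
    (hx : x ∈ Submodule.span ℤ (Set.range b)) :
    ∃ c : ι → ℤ, x = ∑ i, (c i : ℝ) • b i ∧ ∀ i, φ i x = c i := by
  obtain ⟨c, rfl⟩ := (Submodule.mem_span_range_iff_exists_fun ℤ).mp hx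
  have h : ∑ i, c i • b i = ∑ i, (c i : ℝ) • b i := by
    simp only [Int.cast_smul_eq_zsmul]
  exact ⟨c, h, fun i => by rw [h, dual_apply_sum hφ]⟩

theorem IsRealRoot.smul_eq {α : V} {c : ℝ} (hα : IsRealRoot b φ α) (hcα : IsRealRoot b φ (c • α)) :
    c • α = α ∨ c • α = -α := by
  obtain ⟨f, hf, hf1⟩ := hα.primitive
  obtain ⟨g, hg, hg1⟩ := hcα.primitive
  obtain ⟨m, hm⟩ := hf _ hcα.mem
  obtain ⟨n, hn⟩ := hg _ hα.mem
  rw [map_smul, hf1, smul_eq_mul, mul_one] at hm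
  rw [map_smul, hn, hm, smul_eq_mul] at hg1
  have hmn : m * n = 1 := by exact_mod_cast hg1
  rcases Int.eq_one_or_neg_one_of_mul_eq_one hmn with h | h
  · left; rw [hm, h]; simp
  · right; rw [hm, h]; simp

theorem finite_setOf_isRealRoot [Fintype ι] [FiniteDimensional ℝ V]
    (hφ : ∀ i, φ i (b i) = 1 ∧ ∀ j, j ≠ i → φ i (b j) = 0) : {α | IsRealRoot b φ α}.Finite := by
  classical
  obtain ⟨M, hM⟩ := (Set.finite_range fun k => ‖b k‖).bddAbove
  have hnorm : ∀ α, IsRealRoot b φ α → ‖α‖ ≤ M := by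
    intro α hα
    obtain ⟨k, hk⟩ := hα.inner_self
    rw [real_inner_self_eq_norm_sq, real_inner_self_eq_norm_sq] at hk
    have : ‖α‖ = ‖b k‖ := (sq_eq_sq₀ (norm_nonneg _) (norm_nonneg _)).mp hk
    exact this ▸ hM ⟨k, rfl⟩
  let N : ι → ℤ := fun i => ⌈‖(φ i).toContinuousLinearMap‖ * M⌉
  refine ((Set.finite_Icc (-N) N).image fun c : ι → ℤ => ∑ i, (c i : ℝ) • b i).subset ?_
  intro α hα
  obtain ⟨c, hc, hcφ⟩ := eq_sum_dual_smul hφ hα.mem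
  have hbound : ∀ i, |c i| ≤ N i := by
    intro i
    have h1 : |(c i : ℝ)| ≤ ‖(φ i).toContinuousLinearMap‖ * M := by
      rw [← hcφ i]
      exact ((φ i).toContinuousLinearMap.le_opNorm α).trans
        (mul_le_mul_of_nonneg_left (hnorm α hα) (norm_nonneg _))
    have h2 := h1.trans (Int.le_ceil _)
    exact_mod_cast h2
  exact ⟨c, ⟨fun i => (abs_le.mp (hbound i)).1, fun i => (abs_le.mp (hbound i)).2⟩, hc.symm⟩

/-- A root whose coordinates have both signs stays a root after subtracting a suitable basis vector
that occurs in its positive part. -/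
theorem exists_sub_mem_of_mixed [Fintype ι] {Ψ : Set V} (hΨ : IsRootSystem Ψ) (hbΨ : ∀ i, b i ∈ Ψ)
    (hφ : ∀ i, φ i (b i) = 1 ∧ ∀ j, j ≠ i → φ i (b j) = 0)
    (hobt : ∀ i j, i ≠ j → (⟪b i, b j⟫ : ℝ) ≤ 0) {p n : ι → ℕ} (hp : p ≠ 0) (hn : n ≠ 0)
    (hdisj : ∀ i, p i = 0 ∨ n i = 0)
    (hα : ∑ i, (p i : ℝ) • b i - ∑ i, (n i : ℝ) • b i ∈ Ψ) :
    ∃ j, p j ≠ 0 ∧ ∑ i, (p i : ℝ) • b i - ∑ i, (n i : ℝ) • b i - b j ∈ Ψ := by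
  set x := ∑ i, (p i : ℝ) • b i with hx
  set y := ∑ i, (n i : ℝ) • b i with hy
  obtain ⟨k, hk⟩ := Function.ne_iff.mp hp
  obtain ⟨l, hl⟩ := Function.ne_iff.mp hn
  have hx0 : x ≠ 0 := by
    intro h
    have := dual_apply_sum hφ (fun i => (p i : ℝ)) k
    rw [← hx, h, map_zero] at this
    exact hk (by exact_mod_cast this.symm)
  have hsum : (0 : ℝ) < ∑ i, p i * ⟪b i, x⟫ := by
    have h : (∑ i, p i * ⟪b i, x⟫ : ℝ) = ⟪x, x⟫ := by
      conv_rhs => rw [hx, sum_inner]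
      exact Finset.sum_congr rfl fun i _ => by rw [real_inner_smul_left]
    rw [h]
    exact real_inner_self_pos.mpr hx0
  obtain ⟨j, -, hj⟩ := Finset.exists_lt_of_sum_lt (s := Finset.univ) (f := fun _ : ι => (0 : ℝ))
    (g := fun i => (p i : ℝ) * ⟪b i, x⟫) (by simpa using hsum)
  have hpj : p j ≠ 0 := by
    intro h
    simp [h] at hj
  have hjx : (0 : ℝ) < ⟪b j, x⟫ := pos_of_mul_pos_right hj (Nat.cast_nonneg _)
  have hjy : (⟪b j, y⟫ : ℝ) ≤ 0 := by
    rw [hy, inner_sum]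
    refine Finset.sum_nonpos fun i _ => ?_
    rw [real_inner_smul_right]
    by_cases hij : j = i
    · subst hij
      simp [(hdisj j).resolve_left hpj]
    · exact mul_nonpos_of_nonneg_of_nonpos (Nat.cast_nonneg _) (hobt j i hij)
  refine ⟨j, hpj, hΨ.sub_mem hα (hbΨ j) ?_ ?_⟩
  · rw [real_inner_comm, inner_sub_right]
    linarith
  · intro h
    have hpl : p l = 0 := (hdisj l).resolve_right hl
    have h1 := congrArg (φ l) h
    rw [map_sub, hx, hy, dual_apply_sum hφ, dual_apply_sum hφ, hpl,
      (hφ l).2 j (fun hjl => hpj (hjl ▸ hpl))] at h1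
    exact hl (by simpa using h1)

theorem IsRealRoot.ne_sub (hφ : ∀ i, φ i (b i) = 1 ∧ ∀ j, j ≠ i → φ i (b j) = 0)
    (hb0 : ∀ i, b i ≠ 0) (hobt : ∀ i j, i ≠ j → (⟪b i, b j⟫ : ℝ) ≤ 0) {i j : ι} (hij : i ≠ j) :
    ¬ IsRealRoot b φ (b i - b j) := by
  intro h
  obtain ⟨d, hd⟩ := h.coroot_integral i
  rw [map_sub, (hφ i).1, (hφ i).2 j hij.symm, real_inner_sub_sub_self] at hd
  have hi : (0 : ℝ) < ⟪b i, b i⟫ := real_inner_self_pos.mpr (hb0 i)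
  have hj : (0 : ℝ) < ⟪b j, b j⟫ := real_inner_self_pos.mpr (hb0 j)
  have ho := hobt i j hij
  rcases le_or_gt d 0 with h0 | h0
  · have : (d : ℝ) ≤ 0 := by exact_mod_cast h0
    nlinarith
  · have : (1 : ℝ) ≤ d := by exact_mod_cast h0
    nlinarith

theorem sum_sub_single_smul [Fintype ι] (p : ι → ℕ) [DecidableEq ι] {j : ι} (hj : p j ≠ 0) :
    ∑ i, (((p - Pi.single j 1 : ι → ℕ) i : ℕ) : ℝ) • b i = ∑ i, (p i : ℝ) • b i - b j := by
  have h : ∀ i, (((p - Pi.single j 1 : ι → ℕ) i : ℕ) : ℝ) • b i =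
      (p i : ℝ) • b i - if j = i then b i else 0 := by
    intro i
    by_cases hij : j = i
    · subst hij
      rw [Pi.sub_apply, Pi.single_eq_same, Nat.cast_sub (by omega), if_pos rfl, sub_smul]
      simp
    · rw [Pi.sub_apply, Pi.single_eq_of_ne (Ne.symm hij), if_neg hij]
      simp
  rw [Finset.sum_congr rfl fun i _ => h i, Finset.sum_sub_distrib]
  simp

/-- No real root has coordinates of both signs. -/
theorem not_mem_of_mixed [Fintype ι] {Ψ : Set V} (hΨ : IsRootSystem Ψ) (hbΨ : ∀ i, b i ∈ Ψ)
    (hreal : ∀ α ∈ Ψ, IsRealRoot b φ α)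
    (hφ : ∀ i, φ i (b i) = 1 ∧ ∀ j, j ≠ i → φ i (b j) = 0)
    (hobt : ∀ i j, i ≠ j → (⟪b i, b j⟫ : ℝ) ≤ 0) (N : ℕ) :
    ∀ p n : ι → ℕ, ∑ i, p i + ∑ i, n i = N → p ≠ 0 → n ≠ 0 → (∀ i, p i = 0 ∨ n i = 0) →
      ∑ i, (p i : ℝ) • b i - ∑ i, (n i : ℝ) • b i ∉ Ψ := by
  classical
  induction N using Nat.strong_induction_on with
  | _ N ih =>
    intro p n hN hp hn hdisj hα
    have hlt : ∀ (q : ι → ℕ) (j : ι), q j ≠ 0 → ∑ i, (q - Pi.single j 1 : ι → ℕ) i < ∑ i, q i := by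
      intro q j hj
      refine Finset.sum_lt_sum (fun i _ => Nat.sub_le _ _) ⟨j, Finset.mem_univ j, ?_⟩
      rw [Pi.sub_apply, Pi.single_eq_same]
      omega
    have hsub : ∀ (q : ι → ℕ) (j i : ι), q i = 0 → (q - Pi.single j 1 : ι → ℕ) i = 0 := by
      intro q j i h
      rw [Pi.sub_apply, h, Nat.zero_sub]
    have hsingle : ∀ (q : ι → ℕ) (j : ι), q j ≠ 0 → q - Pi.single j 1 = 0 →
        ∑ i, (q i : ℝ) • b i = b j := by
      intro q j hj h
      have := sum_sub_single_smul (b := b) q hj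
      rw [h] at this
      exact sub_eq_zero.mp (by simpa using this.symm)
    obtain ⟨j, hj, hjΨ⟩ := exists_sub_mem_of_mixed hΨ hbΨ hφ hobt hp hn hdisj hα
    have hα' := hΨ.neg_mem hα
    rw [neg_sub] at hα'
    obtain ⟨k, hk, hkΨ⟩ := exists_sub_mem_of_mixed hΨ hbΨ hφ hobt hn hp
      (fun i => (hdisj i).symm) hα'
    by_cases hpj : p - Pi.single j 1 = 0
    · by_cases hnk : n - Pi.single k 1 = 0
      · rw [hsingle p j hj hpj, hsingle n k hk hnk] at hα
        refine IsRealRoot.ne_sub hφ (fun i => hΨ.ne_zero (hbΨ i)) hobt ?_ (hreal _ hα)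
        rintro rfl
        exact (hdisj j).elim hj hk
      · refine ih _ ?_ p (n - Pi.single k 1) rfl hp hnk
          (fun i => (hdisj i).imp_right (hsub n k i)) ?_
        · have := hlt n k hk
          omega
        · rw [sum_sub_single_smul n hk]
          have := hΨ.neg_mem hkΨ
          convert this using 1
          abel
    · refine ih _ ?_ (p - Pi.single j 1) n rfl hpj hn
          (fun i => (hdisj i).imp_left (hsub p j i)) ?_
      · have := hlt p j hj
        omega
      · rw [sum_sub_single_smul p hj]
        convert hjΨ using 1
        abel

end ObtuseBasis

/-- A finite linearly independent set with nonpositive integral Cartan numbers is a base of a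
finite root system. -/
theorem exists_isRootSystem_isBase [FiniteDimensional ℝ V] {T : Set V} (hT : T.Finite)
    (hli : LinearIndependent ℝ ((↑) : T → V))
    (hpair : ∀ x ∈ T, ∀ y ∈ T, x ≠ y → ∃ n : ℤ, n ≤ 0 ∧ pairR x y = n) :
    ∃ Ψ : Set V, IsRootSystem Ψ ∧ Ψ ⊆ (Submodule.span ℝ T : Set V) ∧ IsBase Ψ T := by
  classical
  have := hT.fintype
  obtain ⟨φ, hφ⟩ := hli.exists_dual_family
  have hb0 : ∀ i : T, (i : V) ≠ 0 := fun i => hli.ne_zero i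
  have hpair' : ∀ i j : T, i ≠ j → ∃ n : ℤ, n ≤ 0 ∧ pairR (i : V) (j : V) = n :=
    fun i j hij => hpair i i.2 j j.2 (fun h => hij (Subtype.ext h))
  have hobt : ∀ i j : T, i ≠ j → (⟪(i : V), (j : V)⟫ : ℝ) ≤ 0 := by
    intro i j hij
    obtain ⟨n, hn, h⟩ := hpair' i j hij
    have h1 := pairR_mul_inner_self (hb0 j) (i : V)
    have h2 : (n : ℝ) ≤ 0 := by exact_mod_cast hn
    have h3 := real_inner_self_nonneg (x := (j : V))
    rw [h] at h1
    nlinarith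
  have hreal : ∀ α, ReflClosure T α → IsRealRoot ((↑) : T → V) φ α := by
    intro α hα
    induction hα with
    | basic v hv => exact isRealRoot_basis hφ hb0 hpair' ⟨v, hv⟩
    | refl u v _ _ hu hv => exact hu.reflV hv
  have hΨ : IsRootSystem {α | ReflClosure T α} :=
    ⟨(finite_setOf_isRealRoot hφ).subset hreal, fun h => (hreal 0 h).ne_zero rfl,
      fun α hα β hβ => .refl α β hα hβ,
      fun α hα β hβ => (hreal α hα).integral β (hreal β hβ).mem,
      fun α hα c hc => (hreal α hα).smul_eq (hreal _ hc)⟩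
  have hTΨ : T ⊆ {α | ReflClosure T α} := fun v hv => .basic v hv
  have hspan : {α | ReflClosure T α} ⊆ (Submodule.span ℝ T : Set V) := by
    intro α hα
    obtain ⟨c, hc, -⟩ := eq_sum_dual_smul hφ (hreal α hα).mem
    rw [hc]
    exact sum_mem fun i _ => Submodule.smul_mem _ _ (Submodule.subset_span i.2)
  refine ⟨_, hΨ, hspan, hTΨ, hli, ?_, ?_⟩
  · exact le_antisymm (Submodule.span_mono hTΨ) (Submodule.span_le.mpr hspan)
  · intro α hα
    obtain ⟨c, hc, -⟩ := eq_sum_dual_smul hφ (hreal α hα).mem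
    let e : V →₀ ℤ := (Finsupp.equivFunOnFinite.symm c).embDomain (Function.Embedding.subtype _)
    have hsign : (∀ i, 0 ≤ c i) ∨ ∀ i, c i ≤ 0 := by
      by_contra! hmix
      obtain ⟨⟨k, hk⟩, ⟨l, hl⟩⟩ := hmix
      refine not_mem_of_mixed hΨ (fun i => hTΨ i.2) hreal hφ hobt _
        (fun i => (c i).toNat) (fun i => (-c i).toNat) rfl
        (fun h => ?_) (fun h => ?_) (fun i => ?_) ?_
      · have := congrFun h l
        simp only [Pi.zero_apply] at this
        omega
      · have := congrFun h k
        simp only [Pi.zero_apply] at this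
        omega
      · omega
      · rw [← Finset.sum_sub_distrib]
        convert hα using 1
        rw [hc]
        refine Finset.sum_congr rfl fun i _ => ?_
        rw [← sub_smul]
        congr 1
        have : ((c i).toNat : ℤ) - ((-c i).toNat : ℤ) = c i := by omega
        exact_mod_cast this
    have he : ∀ v (P : ℤ → Prop), P 0 → (∀ i, P (c i)) → P (e v) := by
      intro v P h0 hP
      by_cases hv : v ∈ T
      · have : e v = c ⟨v, hv⟩ :=
          Finsupp.embDomain_apply_self (Function.Embedding.subtype _) _ (⟨v, hv⟩ : T)
        rw [this]
        exact hP _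
      · have : e v = 0 := Finsupp.embDomain_of_notMem_range _ _ _ (by simpa using hv)
        rwa [this]
    refine ⟨e, ?_, ?_, hsign.imp (fun h v => he v (0 ≤ ·) le_rfl h)
      (fun h v => he v (· ≤ 0) le_rfl h)⟩
    · intro v hv
      rw [Finsupp.support_embDomain] at hv
      simp only [Finset.coe_map, Set.mem_image] at hv
      obtain ⟨i, -, rfl⟩ := hv
      exact i.2
    · rw [hc, Finsupp.sum_embDomain, Finsupp.sum_fintype _ _ (by simp)]
      rfl

section Folding

/-- Distinct elements of a base meet at a non-acute angle. -/
theorem IsBase.inner_nonpos {Φ S : Set V} (hΦ : IsRootSystem Φ) (hS : IsBase Φ S) {α β : V}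
    (hα : α ∈ S) (hβ : β ∈ S) (hne : α ≠ β) : (⟪α, β⟫ : ℝ) ≤ 0 := by
  by_contra! hpos
  have : Finite S := hΦ.1.subset hS.1
  obtain ⟨φ, hφ⟩ := hS.2.1.exists_dual_family
  obtain ⟨c, hc, hsum, hsign⟩ := hS.2.2.2 _ (hΦ.sub_mem (hS.1 hα) (hS.1 hβ) hpos hne)
  have key : ∀ i : S, φ i (α - β) = c i := by
    intro i
    rw [hsum, Finsupp.sum, map_sum]
    rw [Finset.sum_eq_single (i : V)]
    · simp [(hφ i).1]
    · intro v hv hvi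
      have := (hφ i).2 ⟨v, hc hv⟩ (fun h => hvi (congrArg Subtype.val h))
      simp only at this
      simp [this]
    · intro h
      simp [Finsupp.notMem_support_iff.mp h]
  have h1 := key ⟨α, hα⟩
  have h2 := key ⟨β, hβ⟩
  have e1 := (hφ ⟨α, hα⟩).1
  have e2 := (hφ ⟨β, hβ⟩).1
  have e3 := (hφ ⟨α, hα⟩).2 ⟨β, hβ⟩ (fun h => hne (congrArg Subtype.val h).symm)
  have e4 := (hφ ⟨β, hβ⟩).2 ⟨α, hα⟩ (fun h => hne (congrArg Subtype.val h))
  simp only at h1 h2 e1 e2 e3 e4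
  rw [map_sub, e1, e3] at h1
  rw [map_sub, e2, e4] at h2
  have h1' : (1 : ℤ) = c α := by exact_mod_cast (by linarith : (1 : ℝ) = c α)
  have h2' : (-1 : ℤ) = c β := by
    have : (-1 : ℝ) = c β := by linarith
    exact_mod_cast this
  rcases hsign with h | h
  · have := h β
    omega
  · have := h α
    omega

theorem IsBase.pairR_int_nonpos {Φ S : Set V} (hΦ : IsRootSystem Φ) (hS : IsBase Φ S) {α β : V}
    (hα : α ∈ S) (hβ : β ∈ S) (hne : α ≠ β) : ∃ n : ℤ, n ≤ 0 ∧ pairR α β = n := by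
  obtain ⟨n, hn⟩ := hΦ.2.2.2.1 β (hS.1 hβ) α (hS.1 hα)
  refine ⟨n, ?_, hn⟩
  have h : pairR α β ≤ 0 := div_nonpos_of_nonpos_of_nonneg
    (by linarith [hS.inner_nonpos hΦ hα hβ hne]) real_inner_self_nonneg
  rw [hn] at h
  exact_mod_cast h

theorem inner_corootV (x v : V) : (⟪x, corootV v⟫ : ℝ) = pairR x v := by
  rw [corootV, real_inner_smul_right, pairR]; ring

open scoped Classical in
/-- The sum of the coroots over the orbit of `α`. -/
noncomputable def orbitSum (s : V → V) (α : V) : V :=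
  if s α = α then corootV α else corootV α + corootV (s α)

theorem orbitSum_map {S : Set V} {s : V → V} (hfold : IsFolding S s) {α : V} (hα : α ∈ S) :
    orbitSum s (s α) = orbitSum s α := by
  by_cases h : s α = α
  · rw [h]
  · have h' : s (s α) ≠ s α := by
      rw [hfold.2.1 α hα]
      exact Ne.symm h
    rw [orbitSum, orbitSum, if_neg h, if_neg h', hfold.2.1 α hα, add_comm]

theorem inner_map_orbitSum {S : Set V} {s : V → V} (hfold : IsFolding S s) {α β : V}
    (hα : α ∈ S) (hβ : β ∈ S) : (⟪s α, orbitSum s β⟫ : ℝ) = ⟪α, orbitSum s β⟫ := by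
  have h := hfold.2.2.2 α hα β hβ
  rw [pairR_sub_left, pairR_sub_left] at h
  unfold orbitSum
  split_ifs with hs
  · rw [hs] at h
    rw [inner_corootV, inner_corootV]
    linarith
  · rw [inner_add_right, inner_add_right, inner_corootV, inner_corootV, inner_corootV,
      inner_corootV]
    linarith

theorem pairR_orbitSum {S : Set V} {s : V → V} (hS0 : ∀ α ∈ S, α ≠ 0) (hfold : IsFolding S s)
    {α β : V} (hα : α ∈ S) (hβ : β ∈ S) :
    pairR (orbitSum s β) (orbitSum s α) = ⟪α, orbitSum s β⟫ := by
  have ha : (⟪α, α⟫ : ℝ) ≠ 0 := inner_self_ne_zero.mpr (hS0 α hα)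
  have hinv := inner_map_orbitSum hfold hα hβ
  set y := orbitSum s β
  by_cases h : s α = α
  · rw [orbitSum, if_pos h, pairR, corootV]
    simp only [real_inner_smul_left, real_inner_smul_right, real_inner_comm α y]
    field_simp
  · have hb : (⟪s α, s α⟫ : ℝ) ≠ 0 := inner_self_ne_zero.mpr (hS0 _ (hfold.1 α hα))
    have horth : (⟪α, s α⟫ : ℝ) = 0 := by
      have := pairR_mul_inner_self (hS0 _ (hfold.1 α hα)) α
      rw [hfold.2.2.1 α hα h] at this
      linarith
    have horth' : (⟪s α, α⟫ : ℝ) = 0 := by rw [real_inner_comm, horth]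
    rw [orbitSum, if_neg h, pairR, corootV, corootV]
    simp only [inner_add_left, inner_add_right, real_inner_smul_left, real_inner_smul_right,
      real_inner_comm α y, real_inner_comm (s α) y, horth, horth', hinv,
      mul_zero, add_zero, zero_add]
    have hab : (⟪s α, s α⟫ + ⟪α, α⟫ : ℝ) ≠ 0 := by
      have h1 := real_inner_self_pos.mpr (hS0 α hα)
      have h2 := real_inner_self_pos.mpr (hS0 _ (hfold.1 α hα))
      positivity
    field_simp

theorem pairR_orbitSum_int_nonpos {Φ S : Set V} (hΦ : IsRootSystem Φ) (hS : IsBase Φ S)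
    {s : V → V} (hfold : IsFolding S s) {α β : V} (hα : α ∈ S) (hβ : β ∈ S)
    (hne : orbitSum s β ≠ orbitSum s α) :
    ∃ n : ℤ, n ≤ 0 ∧ pairR (orbitSum s β) (orbitSum s α) = n := by
  rw [pairR_orbitSum (fun x hx => hΦ.ne_zero (hS.1 hx)) hfold hα hβ]
  obtain ⟨m, hm0, hm⟩ := hS.pairR_int_nonpos hΦ hα hβ (by rintro rfl; exact hne rfl)
  obtain ⟨n, hn0, hn⟩ := hS.pairR_int_nonpos hΦ hα (hfold.1 β hβ)
    (by rintro rfl; exact hne (orbitSum_map hfold hβ).symm)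
  unfold orbitSum
  split_ifs
  · exact ⟨m, hm0, by rw [inner_corootV, hm]⟩
  · exact ⟨m + n, by omega, by rw [inner_add_right, inner_corootV, inner_corootV, hm, hn]; simp⟩

theorem linearIndependent_orbitSums {S : Set V} [Finite S]
    (hli : LinearIndependent ℝ ((↑) : S → V)) {s : V → V} (hfold : IsFolding S s) :
    LinearIndependent ℝ ((↑) : orbitSums s S → V) := by
  classical
  obtain ⟨φ, hφ⟩ := hli.exists_dual_family
  have hcoroot : ∀ i j : S, φ i (corootV (j : V)) = if j = i then 2 / ⟪(j : V), (j : V)⟫ else 0 := by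
    intro i j
    rw [corootV, map_smul]
    split_ifs with h
    · subst h
      simp [(hφ j).1]
    · simp [(hφ i).2 j h]
  have hpos : ∀ i : S, (0 : ℝ) < 2 / ⟪(i : V), (i : V)⟫ := fun i =>
    div_pos two_pos (real_inner_self_pos.mpr (hli.ne_zero i))
  have hdual : ∀ x : orbitSums s S, ∃ f : V →ₗ[ℝ] ℝ,
      f x ≠ 0 ∧ ∀ y : orbitSums s S, y ≠ x → f y = 0 := by
    rintro ⟨_, α, hα, rfl⟩
    refine ⟨φ ⟨α, hα⟩, ?_, ?_⟩
    · have h1 := hcoroot ⟨α, hα⟩ ⟨α, hα⟩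
      have h2 := hcoroot ⟨α, hα⟩ ⟨s α, hfold.1 α hα⟩
      simp only [if_true] at h1
      dsimp only at h2 ⊢
      split_ifs with h
      · rw [h1]
        exact (hpos ⟨α, hα⟩).ne'
      · rw [map_add, h1, h2, if_neg (by simpa using h), add_zero]
        exact (hpos ⟨α, hα⟩).ne'
    · rintro ⟨_, β, hβ, rfl⟩ hne
      have hne' : orbitSum s β ≠ orbitSum s α := fun h => hne (Subtype.ext h)
      have h1 := hcoroot ⟨α, hα⟩ ⟨β, hβ⟩
      have h2 := hcoroot ⟨α, hα⟩ ⟨s β, hfold.1 β hβ⟩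
      rw [if_neg (fun e => hne' (congrArg (orbitSum s) (congrArg Subtype.val e)))] at h1
      rw [if_neg (fun e => hne' ((orbitSum_map hfold hβ).symm.trans
        (congrArg (orbitSum s) (congrArg Subtype.val e))))] at h2
      dsimp only at h1 h2 ⊢
      split_ifs with h
      · exact h1
      · rw [map_add, h1, h2, add_zero]
  rw [linearIndependent_iff']
  intro t g hg x hx
  obtain ⟨f, hfx, hf⟩ := hdual x
  have h := congrArg f hg
  rw [map_sum, Finset.sum_eq_single x, map_smul, map_zero, smul_eq_mul] at h
  · exact (mul_eq_zero.mp h).resolve_right hfx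
  · intro y _ hy
    rw [map_smul, hf y hy, smul_zero]
  · exact fun h => absurd hx h

end Folding

/-- the orbit sums of coroots of a folding are linearly independent, any
two distinct ones pair to a nonpositive integer, and they form the base of a finite
reduced crystallographic root system in their span. -/
theorem stmt7 {V : Type*} [NormedAddCommGroup V] [InnerProductSpace ℝ V]
    [FiniteDimensional ℝ V] (Φ S : Set V)
    (hΦ : IsRootSystem Φ) (hS : IsBase Φ S)
    (s : V → V) (hfold : IsFolding S s) :
    LinearIndependent ℝ ((↑) : orbitSums s S → V) ∧
    (∀ x ∈ orbitSums s S, ∀ y ∈ orbitSums s S, x ≠ y →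
      ∃ n : ℤ, n ≤ 0 ∧ pairR x y = (n : ℝ)) ∧
    ∃ Ψ : Set V, IsRootSystem Ψ ∧
      Ψ ⊆ (Submodule.span ℝ (orbitSums s S) : Set V) ∧
      IsBase Ψ (orbitSums s S) := by
  have hfin : S.Finite := hΦ.1.subset hS.1
  have : Finite S := hfin
  have hli := linearIndependent_orbitSums hS.2.1 hfold
  have hpair : ∀ x ∈ orbitSums s S, ∀ y ∈ orbitSums s S, x ≠ y →
      ∃ n : ℤ, n ≤ 0 ∧ pairR x y = (n : ℝ) := by
    rintro _ ⟨β, hβ, rfl⟩ _ ⟨α, hα, rfl⟩ hne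
    exact pairR_orbitSum_int_nonpos hΦ hS hfold hα hβ hne
  exact ⟨hli, hpair, exists_isRootSystem_isBase (hfin.image _) hli hpair⟩
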